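/- Let μ ∈ ℤⁿ, y₁ ∈ Gr⁰_{−α}, y₂ ∈ Gr_{μ+α}, and v ∈ ℂ^k. Then x_{−α}(v)·y₁ ∈ Gr⁰_{−α}, and π(x_{−α}(v)·m(y₁,y₂)) = m(x_{−α}(v)·y₁, y₂) in Gr_μ. In other words, the multiplication map m : Gr⁰_{−α} × Gr_{μ+α} → Gr_μ is equivariant for the action of the additive group ℂ^k given by v·y := π(x_{−α}(v)·y) on Gr⁰_{−α} and on Gr_μ, with the trivial action on Gr_{μ+α}. -/

import Mathlib

open Matrix

noncomputable section

/-- `K = ℂ((t⁻¹))`, the field of formal Laurent series in `t⁻¹`.  We realize it as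
`LaurentSeries ℂ`, where the Laurent-series variable `X` plays the role of `t⁻¹`;
thus for `f : K`, `f.coeff j` is the coefficient of `t^{-j}`. -/
abbrev K : Type := LaurentSeries ℂ

/-- The element `t` (the inverse of the Laurent series variable). -/
def tK : K := (HahnSeries.single (-1 : ℤ) (1 : ℂ))

/-- The constant embedding `ℂ → K`. -/
def Cc (z : ℂ) : K := HahnSeries.C z

/-- `f ∈ 𝒪 = ℂ[[t⁻¹]]` : no positive powers of `t`. -/
def memO (f : K) : Prop := ∀ j : ℤ, j < 0 → f.coeff j = 0

/-- `f ∈ 𝒪₁ = t⁻¹ℂ[[t⁻¹]]`. -/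
def memO1 (f : K) : Prop := ∀ j : ℤ, j ≤ 0 → f.coeff j = 0

/-- `f ∈ ℂ[t]`. -/
def memPoly (f : K) : Prop := ∀ j : ℤ, 0 < j → f.coeff j = 0

/-- Upper unitriangular matrix. -/
def IsUpperUni {R : Type*} [Zero R] [One R] {m : ℕ} (M : Matrix (Fin m) (Fin m) R) : Prop :=
  (∀ i, M i i = 1) ∧ ∀ i j : Fin m, j < i → M i j = 0

/-- Lower unitriangular matrix. -/
def IsLowerUni {R : Type*} [Zero R] [One R] {m : ℕ} (M : Matrix (Fin m) (Fin m) R) : Prop :=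
  (∀ i, M i i = 1) ∧ ∀ i j : Fin m, i < j → M i j = 0

/-- `M ∈ N₁[[t⁻¹]]` : upper unitriangular with off-diagonal entries in `𝒪₁`. -/
def MemN1 {m : ℕ} (M : Matrix (Fin m) (Fin m) K) : Prop :=
  IsUpperUni M ∧ ∀ i j : Fin m, i ≠ j → memO1 (M i j)

/-- `M ∈ N₋,₁[[t⁻¹]]`. -/
def MemN1neg {m : ℕ} (M : Matrix (Fin m) (Fin m) K) : Prop :=
  IsLowerUni M ∧ ∀ i j : Fin m, i ≠ j → memO1 (M i j)

/-- `M ∈ T₁[[t⁻¹]]` : diagonal with entries in `1 + 𝒪₁`. -/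
def MemT1 {m : ℕ} (M : Matrix (Fin m) (Fin m) K) : Prop :=
  (∀ i j : Fin m, i ≠ j → M i j = 0) ∧ ∀ i, memO1 (M i i - 1)

/-- `M ∈ N[t]` : upper unitriangular with entries in `ℂ[t]`. -/
def MemNpoly {m : ℕ} (M : Matrix (Fin m) (Fin m) K) : Prop :=
  IsUpperUni M ∧ ∀ i j : Fin m, memPoly (M i j)

/-- `M ∈ N₋[t]` : lower unitriangular with entries in `ℂ[t]`. -/
def MemNnegPoly {m : ℕ} (M : Matrix (Fin m) (Fin m) K) : Prop :=
  IsLowerUni M ∧ ∀ i j : Fin m, memPoly (M i j)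

/-- `t^ν = diag(t^{ν₁},…,t^{ν_m})`. -/
def tPow {m : ℕ} (ν : Fin m → ℤ) : Matrix (Fin m) (Fin m) K :=
  Matrix.diagonal fun i => tK ^ ν i

/-- `y = u · h · t^ν · l` is a Gauss factorization exhibiting membership in `Gr_ν`. -/
def IsGauss {m : ℕ} (ν : Fin m → ℤ) (y u h l : Matrix (Fin m) (Fin m) K) : Prop :=
  MemN1 u ∧ MemT1 h ∧ MemN1neg l ∧ y = u * h * tPow ν * l

/-- The matrix slice `Gr_ν = N₁[[t⁻¹]]·T₁[[t⁻¹]]·t^ν·N₋,₁[[t⁻¹]]`. -/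
def GrSlice {m : ℕ} (ν : Fin m → ℤ) : Set (Matrix (Fin m) (Fin m) K) :=
  { y | ∃ u h l, IsGauss ν y u h l }

/-- Block embedding `τ_α : Mat_{k+1} → Mat_n` into (1-indexed) rows and columns `r₁,…,r₁+k`,
identity outside this block. -/
def blockEmbed {R : Type*} [Zero R] [One R] (n r₁ k : ℕ)
    (g : Matrix (Fin (k+1)) (Fin (k+1)) R) : Matrix (Fin n) (Fin n) R :=
  fun i j =>
    if h : r₁ - 1 ≤ (i : ℕ) ∧ (i : ℕ) ≤ r₁ - 1 + k ∧ r₁ - 1 ≤ (j : ℕ) ∧ (j : ℕ) ≤ r₁ - 1 + k then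
      g ⟨(i : ℕ) - (r₁ - 1), by omega⟩ ⟨(j : ℕ) - (r₁ - 1), by omega⟩
    else if i = j then 1 else 0

/-- The coweight `α` of `PGL_n` : `α_{r₁} = 1`, `α_{r₂+1} = -1` (1-indexed), all other
entries `0`. -/
def alphaCo (n r₁ r₂ : ℕ) : Fin n → ℤ :=
  fun i => if (i : ℕ) = r₁ - 1 then 1 else if (i : ℕ) = r₂ then -1 else 0

/-- The matrix `y(p,e,b,g)` (matrix representative of a point of the open Zastava
`Gr⁰_{-α}`), a `(k+1)×(k+1)` matrix over `ℂ[t] ⊆ K`. -/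
def ymat (k : ℕ) (p e : ℂ) (b g : Fin (k-1) → ℂ) :
    Matrix (Fin (k+1)) (Fin (k+1)) K :=
  fun i j =>
    if _hi0 : (i : ℕ) = 0 then
      (if _hjk : (j : ℕ) = k then Cc e else 0)
    else if _hik : (i : ℕ) = k then
      (if _hj0 : (j : ℕ) = 0 then Cc (-e⁻¹)
       else if _hjk : (j : ℕ) = k then tK - Cc (p + ∑ l : Fin (k-1), b l * g l)
       else Cc (-(g ⟨k - (j : ℕ) - 1, by have := j.isLt; omega⟩)))
    else
      (if _hji : (j : ℕ) = (i : ℕ) then 1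
       else if _hjk : (j : ℕ) = k then Cc (b ⟨k - (i : ℕ) - 1, by have := i.isLt; omega⟩)
       else 0)

/-- The matrix `x₋(v)` over `K` : identity except for the bottom row `(v_k,…,v₁,1)`. -/
def xminusK (k : ℕ) (v : Fin k → ℂ) : Matrix (Fin (k+1)) (Fin (k+1)) K :=
  fun i j =>
    if _hik : (i : ℕ) = k then
      (if _hjk : (j : ℕ) = k then 1 else Cc (v ⟨k - (j : ℕ) - 1, by have := j.isLt; omega⟩))
    else if i = j then 1 else 0

/-- `Φ_α(y)` read off from the `N₁[[t⁻¹]]`-factor `u` of a Gauss factorization of `y`. -/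
def PhiOf (n r₂ k : ℕ) (hrn : r₂ < n) (u : Matrix (Fin n) (Fin n) K) : Fin k → ℂ :=
  fun a => (u ⟨r₂ - 1 - (a : ℕ), by omega⟩ ⟨r₂, hrn⟩).coeff 1

/-- `ζ_α(y)` read off from the `N₁[[t⁻¹]]`-factor `u` of a Gauss factorization of `y`. -/
def ZetaOf (n r₁ r₂ k : ℕ) (hr1 : 1 ≤ r₁) (hrr : r₁ ≤ r₂) (hrn : r₂ < n)
    (hk : k = r₂ - r₁ + 1) (u : Matrix (Fin n) (Fin n) K) : Fin k → ℂ :=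
  fun a =>
    if _ha : (a : ℕ) = k - 1 then (u ⟨r₁ - 1, by omega⟩ ⟨r₂, hrn⟩).coeff 2
    else (u ⟨r₁ - 1, by omega⟩ ⟨r₁ + (a : ℕ), by have := a.isLt; omega⟩).coeff 1

/-- `ξ_α(y)`, computed from the `N₁[[t⁻¹]]`-factor `u` of a Gauss factorization of `y`. -/
def xiOf (n r₁ r₂ k : ℕ) (hr1 : 1 ≤ r₁) (hrr : r₁ ≤ r₂) (hrn : r₂ < n)
    (hk : k = r₂ - r₁ + 1) (u : Matrix (Fin n) (Fin n) K) : Matrix (Fin n) (Fin n) K :=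
  let c := PhiOf n r₂ k hrn u
  let z := ZetaOf n r₁ r₂ k hr1 hrr hrn hk u
  let e : ℂ := c ⟨k - 1, by omega⟩
  let b : Fin (k-1) → ℂ := fun i => c ⟨(i : ℕ), by have := i.isLt; omega⟩
  let g : Fin (k-1) → ℂ := fun i => z ⟨k - (i : ℕ) - 2, by omega⟩ / e
  let p : ℂ := z ⟨k - 1, by omega⟩ / e - ∑ i : Fin (k-1), b i * g i
  blockEmbed n r₁ k (ymat k p e b g)

/-- `M` has identity submatrix in (1-indexed) rows and columns `r₁,…,r₁+k`. -/
def HasIdBlock {R : Type*} [Zero R] [One R] {n : ℕ} (r₁ k : ℕ)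
    (M : Matrix (Fin n) (Fin n) R) : Prop :=
  ∀ i j : Fin n, r₁ - 1 ≤ (i : ℕ) → (i : ℕ) ≤ r₁ - 1 + k →
    r₁ - 1 ≤ (j : ℕ) → (j : ℕ) ≤ r₁ - 1 + k →
    M i j = if i = j then 1 else 0

/-- `M ∈ N^α(K)` : upper unitriangular over `K` with identity `(k+1)×(k+1)`-block. -/
def MemNalphaK (n r₁ k : ℕ) (M : Matrix (Fin n) (Fin n) K) : Prop :=
  IsUpperUni M ∧ HasIdBlock r₁ k M

/-- `M ∈ N^α[t]`. -/
def MemNalphaPoly (n r₁ k : ℕ) (M : Matrix (Fin n) (Fin n) K) : Prop :=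
  MemNalphaK n r₁ k M ∧ ∀ i j : Fin n, memPoly (M i j)

/-- `M ∈ N(K)^α₁ = x_α(N_{1,k+1}[[t⁻¹]])·N^α(K)`. -/
def MemNKalpha1 (n r₁ k : ℕ) (M : Matrix (Fin n) (Fin n) K) : Prop :=
  ∃ (a : Matrix (Fin (k+1)) (Fin (k+1)) K) (u : Matrix (Fin n) (Fin n) K),
    MemN1 a ∧ MemNalphaK n r₁ k u ∧ M = blockEmbed n r₁ k a * u

/-- `z = π(x)` for the slice `Gr_ν` : `z ∈ Gr_ν` and `z = a·x·b` with `a ∈ N[t]`,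
`b ∈ N₋[t]`. -/
def IsPiOf {n : ℕ} (ν : Fin n → ℤ) (x z : Matrix (Fin n) (Fin n) K) : Prop :=
  z ∈ GrSlice ν ∧ ∃ a b, MemNpoly a ∧ MemNnegPoly b ∧ z = a * x * b

/-- The open Zastava slice `Gr⁰_{-α} ⊆ GL_n(K)` : matrices `τ_α(y(p,e,b,g))`. -/
def GrZeroNegAlpha (n r₁ k : ℕ) : Set (Matrix (Fin n) (Fin n) K) :=
  { M | ∃ (p e : ℂ) (b g : Fin (k-1) → ℂ), e ≠ 0 ∧ M = blockEmbed n r₁ k (ymat k p e b g) }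

/-- `μ + α`. -/
def addAlpha (n r₁ r₂ : ℕ) (μ : Fin n → ℤ) : Fin n → ℤ :=
  fun i => μ i + alphaCo n r₁ r₂ i

/-- The `ℂ[[t⁻¹]]`-lattice `t^{-N} ℂ[[t⁻¹]]` in `K`, as an additive subgroup. -/
def orderFiltration (N : ℤ) : AddSubgroup K where
  carrier := { f | ∀ j : ℤ, j < N → f.coeff j = 0 }
  zero_mem' := fun _ _ => rfl
  add_mem' := fun hf hg j hj => by simp [hf j hj, hg j hj]
  neg_mem' := fun hf j hj => by simp [hf j hj]

theorem orderFiltration_anti {M N : ℤ} (h : M ≤ N) {f : K} (hf : f ∈ orderFiltration N) :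
    f ∈ orderFiltration M := fun j hj => hf j (hj.trans_le h)

theorem mul_mem_orderFiltration {M N L : ℤ} {f g : K} (hf : f ∈ orderFiltration M)
    (hg : g ∈ orderFiltration N) (hL : L ≤ M + N) : f * g ∈ orderFiltration L := by
  intro j hj
  rw [HahnSeries.coeff_mul]
  refine Finset.sum_eq_zero fun ab hab => ?_
  have hsum := (Finset.mem_antidiagonal.1 hab).2.2
  by_cases h : ab.1 < M
  · rw [hf _ h, zero_mul]
  · rw [hg _ (by omega), mul_zero]

theorem memO1_iff {f : K} : memO1 f ↔ f ∈ orderFiltration 1 :=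
  forall_congr' fun _ => imp_congr_left (by omega)

theorem Cc_mem_orderFiltration (z : ℂ) : Cc z ∈ orderFiltration 0 := by
  intro j hj
  simp [Cc, HahnSeries.coeff_single_of_ne hj.ne]

theorem one_mem_orderFiltration : (1 : K) ∈ orderFiltration 0 := by
  simpa [Cc] using Cc_mem_orderFiltration 1

theorem tK_ne_zero : tK ≠ 0 := by
  simp [tK]

theorem inv_tK_mem_orderFiltration : tK⁻¹ ∈ orderFiltration 1 := by
  have h : tK⁻¹ = HahnSeries.single (1 : ℤ) (1 : ℂ) := by
    refine inv_eq_of_mul_eq_one_right ?_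
    simp [tK]
  rw [h]
  exact fun _ hj => HahnSeries.coeff_single_of_ne hj.ne

theorem mem_orderFiltration_of_mul_tK {N : ℤ} {f : K} (h : f * tK ∈ orderFiltration N) :
    f ∈ orderFiltration (N + 1) := by
  simpa [mul_assoc, tK_ne_zero] using
    mul_mem_orderFiltration h inv_tK_mem_orderFiltration le_rfl

theorem exists_mem_orderFiltration {ι : Type*} [Finite ι] (f : ι → K) :
    ∃ m : ℕ, ∀ i, f i ∈ orderFiltration (-m : ℤ) := by
  cases nonempty_fintype ι
  refine ⟨∑ i, (f i).order.natAbs, fun i j hj => HahnSeries.coeff_eq_zero_of_lt_order ?_⟩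
  have := Finset.single_le_sum (f := fun i => (f i).order.natAbs) (fun _ _ => Nat.zero_le _)
    (Finset.mem_univ i)
  push_cast at hj
  zify at this
  have := neg_abs_le (f i).order
  omega

/-- The subring `ℂ[t]` of `K`. -/
def polySubring : Subring K where
  carrier := { f | memPoly f }
  zero_mem' := fun _ _ => rfl
  one_mem' := fun j hj => by simp [HahnSeries.coeff_one, hj.ne']
  add_mem' := fun hf hg j hj => by simp [hf j hj, hg j hj]
  neg_mem' := fun hf j hj => by simp [hf j hj]
  mul_mem' := fun {f g} hf hg j hj => by
    rw [HahnSeries.coeff_mul]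
    refine Finset.sum_eq_zero fun ab hab => ?_
    have hsum := (Finset.mem_antidiagonal.1 hab).2.2
    by_cases h : 0 < ab.1
    · rw [hf _ h, zero_mul]
    · rw [hg _ (by omega), mul_zero]

theorem Cc_mem_polySubring (z : ℂ) : Cc z ∈ polySubring := fun j hj => by
  simp [Cc, HahnSeries.coeff_single_of_ne hj.ne']

theorem eq_zero_of_memPoly_of_memO1 {f : K} (hf : memPoly f) (hf' : memO1 f) : f = 0 := by
  ext j
  rcases le_or_gt j 0 with h | h
  · exact hf' j h
  · exact hf j h

section UnitriangularMatrices

variable {R : Type*} {m : ℕ} {M N : Matrix (Fin m) (Fin m) R}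

theorem matrix_mul_mem [Ring R] {S : Subring R} (hM : ∀ i j, M i j ∈ S) (hN : ∀ i j, N i j ∈ S)
    (i j : Fin m) : (M * N) i j ∈ S := by
  rw [mul_apply]
  exact sum_mem fun l _ => mul_mem (hM i l) (hN l j)

theorem matrix_inv_mem [CommRing R] {S : Subring R} (hM : ∀ i j, M i j ∈ S) (hdet : M.det = 1)
    (i j : Fin m) : M⁻¹ i j ∈ S := by
  rw [inv_def, hdet, Ring.inverse_one, one_smul, adjugate_apply, det_apply]
  refine sum_mem fun σ _ => zsmul_mem (prod_mem fun l _ => ?_) _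
  rw [updateRow_apply]
  split_ifs
  · rw [Pi.single_apply]
    split_ifs
    exacts [one_mem S, zero_mem S]
  · exact hM _ _

theorem IsUpperUni.blockTriangular [Zero R] [One R] (h : IsUpperUni M) : M.BlockTriangular id :=
  fun _ _ hij => h.2 _ _ hij

theorem IsUpperUni.det [CommRing R] (h : IsUpperUni M) : M.det = 1 := by
  rw [det_of_isUpperTriangular h.blockTriangular]
  exact Finset.prod_eq_one fun i _ => h.1 i

theorem IsUpperUni.mul [CommRing R] (hM : IsUpperUni M) (hN : IsUpperUni N) :
    IsUpperUni (M * N) := by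
  refine ⟨fun i => ?_, fun i j hij => hM.blockTriangular.mul hN.blockTriangular hij⟩
  rw [mul_apply, Finset.sum_eq_single i, hM.1, hN.1, one_mul]
  · intro l _ hl
    rcases lt_or_gt_of_ne hl with h | h
    · rw [hM.2 _ _ h, zero_mul]
    · rw [hN.2 _ _ h, mul_zero]
  · simp

theorem Matrix.BlockTriangular.inv_of_isUnit_det [CommRing R] {α : Type*} [LinearOrder α]
    {b : Fin m → α} (hM : M.BlockTriangular b) (hdet : IsUnit M.det) :
    M⁻¹.BlockTriangular b := by
  let := M.invertibleOfIsUnitDet hdet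
  exact blockTriangular_inv_of_blockTriangular hM

theorem IsUpperUni.inv [CommRing R] (hM : IsUpperUni M) : IsUpperUni M⁻¹ := by
  have hdet : IsUnit M.det := by simp [hM.det]
  have htri := hM.blockTriangular.inv_of_isUnit_det hdet
  refine ⟨fun i => ?_, fun i j hij => htri hij⟩
  have h := congr_fun₂ (M.mul_nonsing_inv hdet) i i
  rw [mul_apply, Finset.sum_eq_single i, hM.1, one_mul, one_apply_eq] at h
  · exact h
  · intro l _ hl
    rcases lt_or_gt_of_ne hl with h | h
    · rw [hM.2 _ _ h, zero_mul]
    · rw [htri h, mul_zero]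
  · simp

theorem IsLowerUni.transpose [Zero R] [One R] (h : IsLowerUni M) : IsUpperUni Mᵀ :=
  ⟨h.1, fun _ _ hij => h.2 _ _ hij⟩

theorem IsUpperUni.transpose [Zero R] [One R] (h : IsUpperUni M) : IsLowerUni Mᵀ :=
  ⟨h.1, fun _ _ hij => h.2 _ _ hij⟩

theorem IsLowerUni.blockTriangular [Zero R] [One R] (h : IsLowerUni M) :
    M.BlockTriangular OrderDual.toDual :=
  fun _ _ hij => h.2 _ _ hij

theorem IsLowerUni.det [CommRing R] (h : IsLowerUni M) : M.det = 1 := by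
  rw [← det_transpose, h.transpose.det]

theorem IsLowerUni.mul [CommRing R] (hM : IsLowerUni M) (hN : IsLowerUni N) :
    IsLowerUni (M * N) := by
  simpa using (hN.transpose.mul hM.transpose).transpose

theorem IsLowerUni.inv [CommRing R] (hM : IsLowerUni M) : IsLowerUni M⁻¹ := by
  simpa [transpose_nonsing_inv] using hM.transpose.inv.transpose

end UnitriangularMatrices

section PolynomialUnipotent

variable {m : ℕ} {M N : Matrix (Fin m) (Fin m) K}

theorem MemNpoly.mul (hM : MemNpoly M) (hN : MemNpoly N) : MemNpoly (M * N) :=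
  ⟨hM.1.mul hN.1, matrix_mul_mem (S := polySubring) hM.2 hN.2⟩

theorem MemNnegPoly.mul (hM : MemNnegPoly M) (hN : MemNnegPoly N) : MemNnegPoly (M * N) :=
  ⟨hM.1.mul hN.1, matrix_mul_mem (S := polySubring) hM.2 hN.2⟩

theorem MemNpoly.inv (hM : MemNpoly M) : MemNpoly M⁻¹ :=
  ⟨hM.1.inv, matrix_inv_mem (S := polySubring) hM.2 hM.1.det⟩

theorem MemNnegPoly.inv (hM : MemNnegPoly M) : MemNnegPoly M⁻¹ :=
  ⟨hM.1.inv, matrix_inv_mem (S := polySubring) hM.2 hM.1.det⟩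

theorem MemT1.eq_diagonal (hM : MemT1 M) : M = diagonal fun i => M i i := by
  ext i j
  by_cases h : i = j
  · simp [h]
  · simp [h, hM.1 i j h]

theorem MemT1.isUnit_det (hM : MemT1 M) : IsUnit M.det := by
  rw [hM.eq_diagonal, det_diagonal, isUnit_iff_ne_zero, Finset.prod_ne_zero_iff]
  intro i _ h0
  simpa [h0] using hM.2 i 0 le_rfl

theorem isUnit_det_tPow (ν : Fin m → ℤ) : IsUnit (tPow ν).det := by
  rw [tPow, det_diagonal, isUnit_iff_ne_zero, Finset.prod_ne_zero_iff]
  exact fun i _ => zpow_ne_zero _ tK_ne_zero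

end PolynomialUnipotent

section BlockEmbedding

variable {n r₁ k : ℕ}

/-- The map collapsing the positions of the block `r₁,…,r₁+k` to a single one; matrices that are
block triangular for it form the standard parabolic with Levi factor containing this block. -/
def blockIdx (n r₁ k : ℕ) (i : Fin n) : ℕ :=
  if r₁ - 1 ≤ (i : ℕ) ∧ (i : ℕ) ≤ r₁ - 1 + k then r₁ - 1 else i

/-- The inclusion of the positions of the block. -/
def blockIncl (hn : r₁ - 1 + k < n) (a : Fin (k + 1)) : Fin n :=
  ⟨r₁ - 1 + a, by omega⟩

theorem blockIncl_injective (hn : r₁ - 1 + k < n) : Function.Injective (blockIncl hn) :=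
  fun a b h => by simpa [blockIncl, Fin.ext_iff] using h

theorem mem_range_blockIncl (hn : r₁ - 1 + k < n) {i : Fin n} :
    i ∈ Set.range (blockIncl hn) ↔ r₁ - 1 ≤ (i : ℕ) ∧ (i : ℕ) ≤ r₁ - 1 + k := by
  constructor
  · rintro ⟨a, rfl⟩
    simp only [blockIncl]
    omega
  · rintro h
    exact ⟨⟨i - (r₁ - 1), by omega⟩, by simp only [blockIncl, Fin.ext_iff]; omega⟩

theorem blockIdx_mono : Monotone (blockIdx n r₁ k) := by
  intro i j hij
  have : (i : ℕ) ≤ j := hij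
  simp only [blockIdx]
  split_ifs <;> omega

theorem blockIdx_blockIncl (hn : r₁ - 1 + k < n) (a : Fin (k + 1)) :
    blockIdx n r₁ k (blockIncl hn a) = r₁ - 1 := by
  have := (mem_range_blockIncl hn).1 ⟨a, rfl⟩
  simp [blockIdx, this]

theorem blockIdx_ne (hn : r₁ - 1 + k < n) {i : Fin n} (hi : i ∉ Set.range (blockIncl hn)) :
    blockIdx n r₁ k i ≠ r₁ - 1 := by
  rw [mem_range_blockIncl] at hi
  simp only [blockIdx, if_neg hi]
  omega

theorem IsUpperUni.blockTriangular_blockIdx {R : Type*} [Zero R] [One R]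
    {M : Matrix (Fin n) (Fin n) R} (h : IsUpperUni M) : M.BlockTriangular (blockIdx n r₁ k) :=
  fun _ _ hij => h.2 _ _ (blockIdx_mono.reflect_lt hij)

theorem submatrix_blockIncl_mul {R : Type*} [CommRing R] (hn : r₁ - 1 + k < n)
    {M N : Matrix (Fin n) (Fin n) R} (hM : M.BlockTriangular (blockIdx n r₁ k))
    (hN : N.BlockTriangular (blockIdx n r₁ k)) :
    (M * N).submatrix (blockIncl hn) (blockIncl hn) =
      M.submatrix (blockIncl hn) (blockIncl hn) * N.submatrix (blockIncl hn) (blockIncl hn) := by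
  ext a b
  rw [submatrix_apply, mul_apply, mul_apply]
  refine (Fintype.sum_of_injective (blockIncl hn) (blockIncl_injective hn) _ _ ?_
    fun _ => rfl).symm
  intro l hl
  rcases lt_or_gt_of_ne (blockIdx_ne hn hl) with h | h
  · rw [hM (by rwa [blockIdx_blockIncl]), zero_mul]
  · rw [hN (by rwa [blockIdx_blockIncl]), mul_zero]

variable {R : Type*} [CommRing R]

theorem blockEmbed_of_notMem (hn : r₁ - 1 + k < n) (A : Matrix (Fin (k + 1)) (Fin (k + 1)) R)
    {i j : Fin n} (h : i ∉ Set.range (blockIncl hn) ∨ j ∉ Set.range (blockIncl hn)) :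
    blockEmbed n r₁ k A i j = (1 : Matrix (Fin n) (Fin n) R) i j := by
  rw [mem_range_blockIncl, mem_range_blockIncl] at h
  rw [blockEmbed, dif_neg (by tauto), one_apply]

theorem blockEmbed_blockIncl (hn : r₁ - 1 + k < n) (A : Matrix (Fin (k + 1)) (Fin (k + 1)) R)
    (a b : Fin (k + 1)) : blockEmbed n r₁ k A (blockIncl hn a) (blockIncl hn b) = A a b := by
  have ha := (mem_range_blockIncl hn).1 ⟨a, rfl⟩
  have hb := (mem_range_blockIncl hn).1 ⟨b, rfl⟩
  rw [blockEmbed, dif_pos ⟨ha.1, ha.2, hb⟩]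
  congr 1 <;> simp [blockIncl]

theorem submatrix_blockEmbed (hn : r₁ - 1 + k < n) (A : Matrix (Fin (k + 1)) (Fin (k + 1)) R) :
    (blockEmbed n r₁ k A).submatrix (blockIncl hn) (blockIncl hn) = A := by
  ext a b
  exact blockEmbed_blockIncl hn A a b

theorem blockTriangular_blockEmbed (hn : r₁ - 1 + k < n)
    (A : Matrix (Fin (k + 1)) (Fin (k + 1)) R) :
    (blockEmbed n r₁ k A).BlockTriangular (blockIdx n r₁ k) := by
  intro i j hij
  rw [blockEmbed_of_notMem hn, one_apply_ne]
  · rintro rfl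
    exact lt_irrefl _ hij
  · by_contra! h
    obtain ⟨⟨a, rfl⟩, ⟨b, rfl⟩⟩ := h
    simp [blockIdx_blockIncl] at hij

theorem blockEmbed_mul (hn : r₁ - 1 + k < n) (A B : Matrix (Fin (k + 1)) (Fin (k + 1)) R) :
    blockEmbed n r₁ k A * blockEmbed n r₁ k B = blockEmbed n r₁ k (A * B) := by
  ext i j
  by_cases hi : i ∈ Set.range (blockIncl hn)
  · by_cases hj : j ∈ Set.range (blockIncl hn)
    · obtain ⟨⟨a, rfl⟩, ⟨b, rfl⟩⟩ := And.intro hi hj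
      have h := congr_fun₂ (submatrix_blockIncl_mul hn (blockTriangular_blockEmbed hn A)
        (blockTriangular_blockEmbed hn B)) a b
      rw [submatrix_blockEmbed, submatrix_blockEmbed] at h
      rw [blockEmbed_blockIncl, ← h, submatrix_apply]
    · rw [blockEmbed_of_notMem hn _ (Or.inr hj), mul_apply,
        Finset.sum_congr rfl fun l _ => by rw [blockEmbed_of_notMem hn B (Or.inr hj)],
        ← mul_apply, mul_one, blockEmbed_of_notMem hn _ (Or.inr hj)]
  · rw [blockEmbed_of_notMem hn _ (Or.inl hi), mul_apply,
      Finset.sum_congr rfl fun l _ => by rw [blockEmbed_of_notMem hn A (Or.inl hi)],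
      ← mul_apply, one_mul, blockEmbed_of_notMem hn _ (Or.inl hi)]

theorem isLowerUni_blockEmbed (hn : r₁ - 1 + k < n) {A : Matrix (Fin (k + 1)) (Fin (k + 1)) R}
    (hA : IsLowerUni A) : IsLowerUni (blockEmbed n r₁ k A) := by
  have key : ∀ i j : Fin n, i ≤ j →
      blockEmbed n r₁ k A i j = (1 : Matrix (Fin n) (Fin n) R) i j := by
    intro i j hij
    by_cases h : i ∈ Set.range (blockIncl hn) ∧ j ∈ Set.range (blockIncl hn)
    · obtain ⟨⟨a, rfl⟩, ⟨b, rfl⟩⟩ := h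
      have hab : a ≤ b := by
        simp only [blockIncl, Fin.le_def] at hij ⊢
        omega
      rw [blockEmbed_blockIncl]
      rcases hab.eq_or_lt with rfl | hab
      · rw [hA.1, one_apply_eq]
      · rw [hA.2 _ _ hab, one_apply_ne ((blockIncl_injective hn).ne hab.ne)]
    · exact blockEmbed_of_notMem hn A (by tauto)
  exact ⟨fun i => by rw [key i i le_rfl, one_apply_eq],
    fun i j hij => by rw [key i j hij.le, one_apply_ne hij.ne]⟩

theorem blockEmbed_mem {A : Matrix (Fin (k + 1)) (Fin (k + 1)) R}
    {S : Subring R} (hA : ∀ a b, A a b ∈ S) (i j : Fin n) : blockEmbed n r₁ k A i j ∈ S := by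
  unfold blockEmbed
  split_ifs
  exacts [hA _ _, one_mem S, zero_mem S]

theorem isUpperUni_and_submatrix_eq_one_iff (hn : r₁ - 1 + k < n) {M : Matrix (Fin n) (Fin n) R} :
    IsUpperUni M ∧ M.submatrix (blockIncl hn) (blockIncl hn) = 1 ↔
      ∀ i j, blockIdx n r₁ k j ≤ blockIdx n r₁ k i → (M - 1) i j = 0 := by
  simp only [Matrix.sub_apply, sub_eq_zero]
  constructor
  · rintro ⟨hM, hblock⟩ i j hij
    by_cases h : i ∈ Set.range (blockIncl hn) ∧ j ∈ Set.range (blockIncl hn)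
    · obtain ⟨⟨a, rfl⟩, ⟨b, rfl⟩⟩ := h
      have := congr_fun₂ hblock a b
      rw [submatrix_apply] at this
      rw [this, one_apply, one_apply]
      simp [(blockIncl_injective hn).eq_iff]
    · have hji : j ≤ i := by
        simp only [mem_range_blockIncl] at h
        simp only [blockIdx] at hij
        rw [Fin.le_def]
        split_ifs at hij <;> omega
      rcases hji.eq_or_lt with rfl | hji
      · rw [hM.1, one_apply_eq]
      · rw [hM.2 _ _ hji, one_apply_ne hji.ne']
  · intro h
    refine ⟨⟨fun i => by rw [h i i le_rfl, one_apply_eq],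
      fun i j hij => by rw [h i j (blockIdx_mono hij.le), one_apply_ne hij.ne']⟩, ?_⟩
    ext a b
    rw [submatrix_apply, h _ _ (by rw [blockIdx_blockIncl, blockIdx_blockIncl]), one_apply,
      one_apply]
    simp [(blockIncl_injective hn).eq_iff]

/-- Upper unitriangular matrices with trivial block form a normal subgroup of the parabolic. -/
theorem isUpperUni_conj (hn : r₁ - 1 + k < n) {M X : Matrix (Fin n) (Fin n) R}
    (hM : IsUpperUni M) (hblock : M.submatrix (blockIncl hn) (blockIncl hn) = 1)
    (hX : X.BlockTriangular (blockIdx n r₁ k)) (hdet : IsUnit X.det) :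
    IsUpperUni (X * M * X⁻¹) := by
  have hM' := (isUpperUni_and_submatrix_eq_one_iff hn).1 ⟨hM, hblock⟩
  refine ((isUpperUni_and_submatrix_eq_one_iff hn).2 fun i j hij => ?_).1
  have heq : X * M * X⁻¹ - 1 = X * (M - 1) * X⁻¹ := by
    rw [mul_sub, sub_mul, mul_one, X.mul_nonsing_inv hdet]
  rw [heq, mul_apply]
  refine Finset.sum_eq_zero fun l _ => ?_
  by_cases hl : blockIdx n r₁ k j < blockIdx n r₁ k l
  · rw [hX.inv_of_isUnit_det hdet hl, mul_zero]
  · rw [mul_apply, Finset.sum_eq_zero, zero_mul]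
    intro l' _
    by_cases hl' : blockIdx n r₁ k l' < blockIdx n r₁ k i
    · rw [hX hl', zero_mul]
    · rw [hM' _ _ (by omega), mul_zero]

end BlockEmbedding

section SliceMatrix

variable {k : ℕ}

theorem isLowerUni_xminusK (v : Fin k → ℂ) : IsLowerUni (xminusK k v) := by
  refine ⟨fun i => ?_, fun i j hij => ?_⟩
  · simp only [xminusK]
    split_ifs <;> simp_all
  · have hlt : (i : ℕ) < j := hij
    have hi : (i : ℕ) ≠ k := by omega
    simp [xminusK, hi, hij.ne]

theorem xminusK_mem_polySubring (v : Fin k → ℂ) (i j : Fin (k + 1)) :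
    xminusK k v i j ∈ polySubring := by
  simp only [xminusK]
  split_ifs
  exacts [one_mem _, Cc_mem_polySubring _, one_mem _, zero_mem _]

theorem xminusK_mul_apply_of_ne (v : Fin k → ℂ) (Y : Matrix (Fin (k + 1)) (Fin (k + 1)) K)
    {i : Fin (k + 1)} (hi : (i : ℕ) ≠ k) (j : Fin (k + 1)) :
    (xminusK k v * Y) i j = Y i j := by
  rw [mul_apply, Finset.sum_eq_single i]
  · simp [xminusK, hi]
  · intro l _ hl
    simp [xminusK, hi, hl.symm]
  · simp

theorem xminusK_mul_last (v : Fin k → ℂ) (Y : Matrix (Fin (k + 1)) (Fin (k + 1)) K)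
    (j : Fin (k + 1)) :
    (xminusK k v * Y) (Fin.last k) j =
      ∑ a : Fin k, Cc (v a.rev) * Y a.castSucc j + Y (Fin.last k) j := by
  rw [mul_apply, Fin.sum_univ_castSucc]
  congr 1
  · refine Finset.sum_congr rfl fun a _ => ?_
    congr 1
    have ha : (a : ℕ) ≠ k := by omega
    simp only [xminusK, Fin.val_last, Fin.val_castSucc, dif_neg ha, dif_pos]
    congr 2
  · simp [xminusK]

/-- Left multiplication by `x₋(v)` translates the parameters `g` and `p` of the slice. -/
theorem xminusK_mul_ymat {m : ℕ} (p e : ℂ) (b g : Fin m → ℂ) (v : Fin (m + 1) → ℂ) :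
    xminusK (m + 1) v * ymat (m + 1) p e b g =
      ymat (m + 1) (p - v (Fin.last m) * e) e b (fun l => g l - v l.castSucc) := by
  ext1 i j
  by_cases hi : (i : ℕ) = m + 1
  · obtain rfl : i = Fin.last (m + 1) := Fin.ext hi
    rw [xminusK_mul_last, Fin.sum_univ_succ]
    have hne : ∀ a : Fin m, (a : ℕ) ≠ m := fun a => a.isLt.ne
    have hrev : ∀ (a : Fin m) (h : m - (a : ℕ) - 1 < m),
        (⟨m - (a : ℕ) - 1, h⟩ : Fin m) = a.rev := fun a _ => by
      simp only [Fin.ext_iff, Fin.val_rev]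
      omega
    rcases Fin.eq_castSucc_or_eq_last j with ⟨j, rfl⟩ | rfl
    · rcases Fin.eq_zero_or_eq_succ j with rfl | ⟨j, rfl⟩
      · simp [ymat, hne]
      · simp [ymat, hne, hrev, Fin.val_inj, Fin.rev_succ, Cc, -HahnSeries.C_apply]
        ring
    · have hsum := Equiv.sum_comp Fin.revPerm fun a : Fin m =>
        HahnSeries.C (b a) * (HahnSeries.C (v a.castSucc) : K)
      simp only [Fin.revPerm_apply] at hsum
      simp [ymat, hne, fun a => (hne a).symm, hrev, Fin.rev_succ, Cc, -HahnSeries.C_apply,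
        mul_sub, Finset.sum_sub_distrib, mul_comm]
      linear_combination hsum
  · rw [xminusK_mul_apply_of_ne _ _ hi]
    simp [ymat, hi]

variable {p e : ℂ} {b g : Fin (k - 1) → ℂ}

/-- Away from its corner entry, the matrix `y(p,e,b,g)` is constant. -/
theorem ymat_mem_orderFiltration {i j : Fin (k + 1)} (h : ¬ ((i : ℕ) = k ∧ (j : ℕ) = k)) :
    ymat k p e b g i j ∈ orderFiltration 0 := by
  simp only [ymat]
  split_ifs
  all_goals first
    | exact Cc_mem_orderFiltration _
    | exact zero_mem _
    | exact one_mem_orderFiltration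
    | omega

theorem ymat_last_last_sub_mem (hk : k ≠ 0) :
    ymat k p e b g (Fin.last k) (Fin.last k) - tK ∈ orderFiltration 0 := by
  simpa [ymat, hk] using neg_mem (Cc_mem_orderFiltration (p + ∑ l, b l * g l))

theorem ymat_of_ne_last {i j : Fin (k + 1)} (hi : (i : ℕ) ≠ k) (hj : (j : ℕ) ≠ k)
    (hj0 : (j : ℕ) ≠ 0) : ymat k p e b g i j = (1 : Matrix (Fin (k + 1)) (Fin (k + 1)) K) i j := by
  simp only [ymat, one_apply, Fin.ext_iff]
  split_ifs <;> first | rfl | omega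

theorem ymat_mul_sub_ymat_mem {U : Matrix (Fin (k + 1)) (Fin (k + 1)) K}
    (hU : MemN1 U) (i j : Fin (k + 1)) :
    (ymat k p e b g * U) i j - ymat k p e b g i j ∈ orderFiltration 1 := by
  have heq : (ymat k p e b g * U) i j - ymat k p e b g i j =
      (ymat k p e b g * (U - 1)) i j := by
    rw [mul_sub, mul_one, Matrix.sub_apply]
  rw [heq, mul_apply]
  refine sum_mem fun l _ => ?_
  by_cases hlj : l = j
  · simp [hlj, hU.1.1 j]
  · rw [Matrix.sub_apply, one_apply_ne hlj, sub_zero]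
    by_cases hl : (l : ℕ) = k
    · have hjl : j < l := by rw [Fin.lt_def]; rw [Fin.ext_iff] at hlj; omega
      rw [hU.1.2 _ _ hjl, mul_zero]
      exact zero_mem _
    · exact mul_mem_orderFiltration (ymat_mem_orderFiltration (by tauto))
        (memO1_iff.1 (hU.2 _ _ hlj)) (by norm_num)

/-- One step of the descent showing that a row of the unipotent factor is small. -/
theorem row_mem_orderFiltration_succ (hk : k ≠ 0) {U : Matrix (Fin (k + 1)) (Fin (k + 1)) K}
    (hU : MemN1 U) {i : Fin (k + 1)} {c : Fin (k + 1) → K} {N : ℤ}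
    (hc : ∀ l, c l ∈ orderFiltration N)
    (hvanish : ∀ j, i < j → ∑ l, c l * (ymat k p e b g * U) l j = 0) {j : Fin (k + 1)}
    (hij : i < j) : c j ∈ orderFiltration (N + 1) := by
  set M := ymat k p e b g * U with hM
  have hdiff : ∀ l j, M l j - ymat k p e b g l j ∈ orderFiltration 1 :=
    ymat_mul_sub_ymat_mem hU
  have hmem : ∀ {l j : Fin (k + 1)}, ¬ ((l : ℕ) = k ∧ (j : ℕ) = k) →
      M l j ∈ orderFiltration 0 := fun {l j} h => by
    simpa using add_mem (orderFiltration_anti zero_le_one (hdiff l j))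
      (ymat_mem_orderFiltration (p := p) (e := e) (b := b) (g := g) h)
  have hlast : ∀ j, i < j → c (Fin.last k) ∈ orderFiltration (N + 1) := fun j hij => by
    apply mem_orderFiltration_of_mul_tK
    have hik : i < Fin.last k := hij.trans_le (Fin.le_last j)
    have hsum := hvanish _ hik
    rw [Fin.sum_univ_castSucc] at hsum
    have heq : c (Fin.last k) * tK = -(∑ l : Fin k, c l.castSucc * M l.castSucc (Fin.last k) +
        c (Fin.last k) * (M (Fin.last k) (Fin.last k) - tK)) := by
      linear_combination hsum
    rw [heq]
    refine neg_mem (add_mem (sum_mem fun l _ => mul_mem_orderFiltration (hc _) (hmem ?_)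
      (by simp)) (mul_mem_orderFiltration (hc _) (N := 0) ?_ (by simp)))
    · simp only [Fin.val_castSucc]
      omega
    · simpa using add_mem (orderFiltration_anti zero_le_one (hdiff (Fin.last k) (Fin.last k)))
        (ymat_last_last_sub_mem (p := p) (e := e) (b := b) (g := g) hk)
  by_cases hj : (j : ℕ) = k
  · obtain rfl : j = Fin.last k := Fin.ext hj
    exact hlast _ hij
  · have heq : c j = -∑ l, c l * (M l j - (1 : Matrix (Fin (k + 1)) (Fin (k + 1)) K) l j) := by
      simp only [mul_sub, Finset.sum_sub_distrib, hvanish j hij]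
      simp [one_apply]
    rw [heq]
    refine neg_mem (sum_mem fun l _ => ?_)
    by_cases hl : (l : ℕ) = k
    · obtain rfl : l = Fin.last k := Fin.ext hl
      rw [one_apply_ne (by rintro rfl; exact hj rfl), sub_zero]
      exact mul_mem_orderFiltration (hlast j hij) (hmem (by tauto)) (by simp)
    · rw [← ymat_of_ne_last (p := p) (e := e) (b := b) (g := g) hl hj
        (by rw [Fin.lt_def] at hij; omega)]
      exact mul_mem_orderFiltration (hc l) (hdiff l j) le_rfl

/-- If `C` is upper unitriangular and `C·y·U` is lower triangular for some `U ∈ N₁[[t⁻¹]]`, then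
`C ∈ N₁[[t⁻¹]]`. -/
theorem memN1_of_mul_ymat_mul (hk : k ≠ 0) {C U : Matrix (Fin (k + 1)) (Fin (k + 1)) K}
    (hC : IsUpperUni C) (hU : MemN1 U)
    (hlower : ∀ i j, i < j → (C * (ymat k p e b g * U)) i j = 0) : MemN1 C := by
  refine ⟨hC, fun i j hij => ?_⟩
  rcases lt_or_gt_of_ne hij with hij | hij
  swap
  · rw [hC.2 _ _ hij]
    exact fun _ _ => rfl
  have step : ∀ N : ℤ, (∀ l, C i l ∈ orderFiltration N) → ∀ l, i < l →
      C i l ∈ orderFiltration (N + 1) := fun N hN l hl =>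
    row_mem_orderFiltration_succ hk hU hN (fun j hj => by rw [← mul_apply, hlower i j hj]) hl
  have descent : ∀ m : ℕ, (∀ l, C i l ∈ orderFiltration (-m : ℤ)) →
      ∀ l, C i l ∈ orderFiltration 0 := by
    intro m
    induction m with
    | zero => simp
    | succ m ih =>
      refine fun hm => ih fun l => ?_
      rcases lt_trichotomy i l with h | rfl | h
      · exact orderFiltration_anti (by push_cast; omega) (step _ hm l h)
      · rw [hC.1]
        exact orderFiltration_anti (by omega) one_mem_orderFiltration
      · rw [hC.2 _ _ h]
        exact zero_mem _
  obtain ⟨m, hm⟩ := exists_mem_orderFiltration fun l => C i l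
  exact memO1_iff.2 (by simpa using step 0 (descent m hm) j hij)

end SliceMatrix

theorem MemN1.submatrix_blockIncl {n r₁ k : ℕ} (hn : r₁ - 1 + k < n)
    {u : Matrix (Fin n) (Fin n) K} (hu : MemN1 u) :
    MemN1 (u.submatrix (blockIncl hn) (blockIncl hn)) := by
  have hlt : ∀ a b : Fin (k + 1), b < a → blockIncl hn b < blockIncl hn a := fun a b h => by
    simpa [blockIncl] using h
  exact ⟨⟨fun a => hu.1.1 _, fun a b h => hu.1.2 _ _ (hlt a b h)⟩,
    fun a b h => hu.2 _ _ ((blockIncl_injective hn).ne h)⟩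

/-- The factor in `N[t]` used to compute `m(y₁, y₂)` has trivial block. -/
theorem submatrix_eq_one_of_mul_mem_grSlice {n r₁ k : ℕ} (hn : r₁ - 1 + k < n) (hk : k ≠ 0)
    {p e : ℂ} {b g : Fin (k - 1) → ℂ} {μ ν : Fin n → ℤ} {y a c : Matrix (Fin n) (Fin n) K}
    (hy : y ∈ GrSlice ν) (ha : MemNpoly a) (hc : MemNnegPoly c)
    (hz : a * (blockEmbed n r₁ k (ymat k p e b g) * y) * c ∈ GrSlice μ) :
    a.submatrix (blockIncl hn) (blockIncl hn) = 1 := by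
  obtain ⟨u₂, h₂, l₂, hu₂, hh₂, hl₂, rfl⟩ := hy
  obtain ⟨u, h, l, hu, hh, hl, hz⟩ := hz
  set Y := blockEmbed n r₁ k (ymat k p e b g) with hY
  have hudet : IsUnit u.det := by simp [hu.1.det]
  set L := h₂ * tPow ν * l₂ * c with hL
  have hdiag : ∀ {w : Matrix (Fin n) (Fin n) K}, MemT1 w →
      w.BlockTriangular OrderDual.toDual := fun hw => by
    rw [hw.eq_diagonal]
    exact blockTriangular_diagonal _
  have hLtri : L.BlockTriangular OrderDual.toDual :=
    (((hdiag hh₂).mul (blockTriangular_diagonal _)).mul hl₂.1.blockTriangular).mul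
      hc.1.blockTriangular
  have hLdet : IsUnit L.det := by
    simp only [hL, det_mul, hl₂.1.det, hc.1.det, mul_one]
    exact hh₂.isUnit_det.mul (isUnit_det_tPow ν)
  have hR : (h * tPow μ * l * L⁻¹).BlockTriangular OrderDual.toDual :=
    (((hdiag hh).mul (blockTriangular_diagonal _)).mul hl.1.blockTriangular).mul
      (hLtri.inv_of_isUnit_det hLdet)
  have heq : u⁻¹ * a * (Y * u₂) = h * tPow μ * l * L⁻¹ := by
    have h1 : a * (Y * u₂) * L = u * (h * tPow μ * l) := by
      simp only [hL, ← mul_assoc] at hz ⊢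
      exact hz
    calc u⁻¹ * a * (Y * u₂) = u⁻¹ * (a * (Y * u₂) * L) * L⁻¹ := by
          rw [mul_assoc u⁻¹ _ L⁻¹, mul_nonsing_inv_cancel_right _ _ hLdet, mul_assoc]
      _ = _ := by rw [h1, nonsing_inv_mul_cancel_left _ _ hudet]
  have hC : IsUpperUni (u⁻¹ * a) := hu.1.inv.mul ha.1
  have hYu : (Y * u₂).BlockTriangular (blockIdx n r₁ k) :=
    (blockTriangular_blockEmbed hn _).mul hu₂.1.blockTriangular_blockIdx
  have hCblock : MemN1 ((u⁻¹ * a).submatrix (blockIncl hn) (blockIncl hn)) := by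
    refine memN1_of_mul_ymat_mul (p := p) (e := e) (b := b) (g := g) hk ?_
      (hu₂.submatrix_blockIncl hn) fun i j hij => ?_
    · exact ⟨fun a => hC.1 _, fun i j hij => hC.2 _ _ (by simpa [blockIncl] using hij)⟩
    · have hblock := submatrix_blockIncl_mul hn hC.blockTriangular_blockIdx hYu
      rw [submatrix_blockIncl_mul hn (blockTriangular_blockEmbed hn _)
        hu₂.1.blockTriangular_blockIdx, submatrix_blockEmbed, heq] at hblock
      rw [← hblock, submatrix_apply]
      refine hR ?_
      simpa [blockIncl] using hij
  have hfac := submatrix_blockIncl_mul hn hu.1.blockTriangular_blockIdx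
    hC.blockTriangular_blockIdx
  rw [mul_nonsing_inv_cancel_left _ _ hudet] at hfac
  have hublock := hu.submatrix_blockIncl hn
  have hentry : ∀ {B : Matrix (Fin (k + 1)) (Fin (k + 1)) K}, MemN1 B → ∀ i j,
      B i j ∈ orderFiltration 0 := fun {B} hB i j => by
    by_cases hij : i = j
    · rw [hij, hB.1.1]
      exact one_mem_orderFiltration
    · exact orderFiltration_anti zero_le_one (memO1_iff.1 (hB.2 i j hij))
  ext1 i j
  by_cases hij : i = j
  · rw [hij, one_apply_eq]
    exact ha.1.1 _
  · rw [one_apply_ne hij]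
    refine eq_zero_of_memPoly_of_memO1 (ha.2 _ _) (memO1_iff.2 ?_)
    rw [hfac, mul_apply]
    refine sum_mem fun s _ => ?_
    by_cases his : i = s
    · exact mul_mem_orderFiltration (hentry hublock i s)
        (memO1_iff.1 (hCblock.2 s j (his ▸ hij))) (by norm_num)
    · exact mul_mem_orderFiltration (memO1_iff.1 (hublock.2 i s his)) (hentry hCblock s j)
        (by norm_num)

theorem isPiOf_mul_mul_iff {n : ℕ} {ν : Fin n → ℤ} {a b x : Matrix (Fin n) (Fin n) K}
    (ha : MemNpoly a) (hb : MemNnegPoly b) (w : Matrix (Fin n) (Fin n) K) :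
    IsPiOf ν (a * x * b) w ↔ IsPiOf ν x w := by
  have hadet : IsUnit a.det := by simp [ha.1.det]
  have hbdet : IsUnit b.det := by simp [hb.1.det]
  refine and_congr_right fun _ => ⟨?_, ?_⟩
  · rintro ⟨a', b', ha', hb', rfl⟩
    exact ⟨a' * a, b * b', ha'.mul ha, hb.mul hb', by simp only [mul_assoc]⟩
  · rintro ⟨a', b', ha', hb', rfl⟩
    refine ⟨a' * a⁻¹, b⁻¹ * b', ha'.mul ha.inv, hb.inv.mul hb', ?_⟩
    simp only [mul_assoc, nonsing_inv_mul_cancel_left _ _ hadet,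
      mul_nonsing_inv_cancel_left _ _ hbdet]

/-- The multiplication map `m : Gr⁰_{−α} × Gr_{μ+α} → Gr_μ` is
equivariant for the action `v · y := π(x_{−α}(v)·y)` of the additive group `ℂ^k`
(trivial action on `Gr_{μ+α}`): `x_{−α}(v)·y₁ ∈ Gr⁰_{−α}` and
`π(x_{−α}(v)·m(y₁,y₂)) = m(x_{−α}(v)·y₁, y₂)`. -/
theorem statement10 (n r₁ r₂ k : ℕ) (hn : 2 ≤ n) (hr1 : 1 ≤ r₁) (hrr : r₁ ≤ r₂)
    (hrn : r₂ < n) (hk : k = r₂ - r₁ + 1) (μ : Fin n → ℤ)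
    (p e : ℂ) (he : e ≠ 0) (b g : Fin (k-1) → ℂ)
    (y₂ : Matrix (Fin n) (Fin n) K) (hy₂ : y₂ ∈ GrSlice (addAlpha n r₁ r₂ μ))
    (v : Fin k → ℂ) :
    (blockEmbed n r₁ k (xminusK k v) * blockEmbed n r₁ k (ymat k p e b g)
        ∈ GrZeroNegAlpha n r₁ k) ∧
    (∀ z, IsPiOf μ (blockEmbed n r₁ k (ymat k p e b g) * y₂) z →
      ∀ w, (IsPiOf μ (blockEmbed n r₁ k (xminusK k v) * z) w ↔
        IsPiOf μ
          (blockEmbed n r₁ k (xminusK k v) * blockEmbed n r₁ k (ymat k p e b g) * y₂)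
          w)) := by
  have hn' : r₁ - 1 + k < n := by omega
  obtain ⟨m, rfl⟩ : ∃ m, k = m + 1 := ⟨r₂ - r₁, hk⟩
  refine ⟨?_, ?_⟩
  · rw [blockEmbed_mul hn']
    exact ⟨_, e, b, _, he, congr_arg _ (xminusK_mul_ymat p e b g v)⟩
  · rintro z ⟨hz, a, c, ha, hc, rfl⟩ w
    set X := blockEmbed n r₁ (m + 1) (xminusK (m + 1) v) with hX
    have hXuni : IsLowerUni X := isLowerUni_blockEmbed hn' (isLowerUni_xminusK v)
    have hXpoly : ∀ i j, X i j ∈ polySubring := blockEmbed_mem (xminusK_mem_polySubring v)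
    have hXdet : IsUnit X.det := by simp [hXuni.det]
    have hconj : MemNpoly (X * a * X⁻¹) :=
      ⟨isUpperUni_conj hn' ha.1
        (submatrix_eq_one_of_mul_mem_grSlice hn' m.succ_ne_zero hy₂ ha hc hz)
        (blockTriangular_blockEmbed hn' _) hXdet,
        matrix_mul_mem (matrix_mul_mem hXpoly ha.2) (matrix_inv_mem hXpoly hXuni.det)⟩
    rw [← isPiOf_mul_mul_iff hconj hc (x := _ * y₂)]
    simp only [mul_assoc, nonsing_inv_mul_cancel_left _ _ hXdet]

end
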